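/- Let G* be the counterexample digraph with vertex set {s, t, a, b, c1, c2, c3, c4, c5, b1, b2, b3, m1, m2} and three edge groups: the black edges I = {(s,a), (a,b), (b,t)}; the orange edges X = {(s,c1), (c1,c2), (c2,a), (a,m1), (m1,c3), (c3,c4), (c4,m2), (m2,c5), (c5,t)}; the blue edges Y = {(s,b1), (b1,m1), (m1,m2), (m2,b), (b,b2), (b2,b3), (b3,t)}. Give every edge the travel-time function c(x) = 1/(1 − x/10), and route demand 5 from s to t. Call a feasible path flow x on edge set E' a Wardrop equilibrium if for every pair of s–t paths p1, p2 in E' with x_{p1} > 0, the cost of p1 is at most the cost of p2, where the cost of a path p is ∑_{e∈p} 1/(1 − x_e/10) and x_e is the total flow through e. Then: (i) on each of the edge sets I, I ∪ X, and I ∪ Y, the flow sending all 5 units along the black path (s,a,b,t) is a Wardrop equilibrium with total travel time 30; (ii) on I ∪ X ∪ Y, the flow sending 35/8 units along (s,a,b,t) and 5/8 units along the 5-edge path (s,b1,m1,m2,c5,t) is a Wardrop equilibrium with total travel time 80/3. Consequently 30 − 30 < 30 − 80/3, so the total travel time at user equilibrium is NOT supermodular with respect to path additions. -/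

import Mathlib

/-- The vertex set of the counterexample digraph. -/
inductive V14 : Type
  | s | t | a | b | c1 | c2 | c3 | c4 | c5 | b1 | b2 | b3 | m1 | m2
  deriving DecidableEq

open V14

/-- The black edges `I = {(s,a), (a,b), (b,t)}`. -/
def blackEdges : Finset (V14 × V14) := {(s, a), (a, b), (b, t)}

/-- The orange edges
`X = {(s,c1), (c1,c2), (c2,a), (a,m1), (m1,c3), (c3,c4), (c4,m2), (m2,c5), (c5,t)}`. -/
def orangeEdges : Finset (V14 × V14) :=
  {(s, c1), (c1, c2), (c2, a), (a, m1), (m1, c3), (c3, c4), (c4, m2), (m2, c5), (c5, t)}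

/-- The blue edges
`Y = {(s,b1), (b1,m1), (m1,m2), (m2,b), (b,b2), (b2,b3), (b3,t)}`. -/
def blueEdges : Finset (V14 × V14) :=
  {(s, b1), (b1, m1), (m1, m2), (m2, b), (b, b2), (b2, b3), (b3, t)}

/-- A list of vertices is a directed `s`–`t` path in the edge set `E'` if its
consecutive pairs are edges of `E'`, all its vertices are distinct, it starts
at `s` and ends at `t`. -/
def IsSTPath (E' : Finset (V14 × V14)) (l : List V14) : Prop :=
  l.Chain' (fun x y => (x, y) ∈ E') ∧ l.Nodup ∧
  l.head? = some V14.s ∧ l.getLast? = some V14.t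

/-- The flow induced on edge `e` by a (finitely supported) path flow `x`:
the sum of the flows of the paths containing `e` as a consecutive pair. -/
noncomputable def edgeFlow (x : List V14 →₀ ℝ) (e : V14 × V14) : ℝ :=
  ∑ l ∈ x.support, if e ∈ l.zip l.tail then x l else 0

/-- The cost of a path `l` under the path flow `x`: the sum over the edges
`e` of `l` of the travel time `1/(1 − x_e/10)`, where `x_e` is the total flow
through `e`. -/
noncomputable def pathCost (x : List V14 →₀ ℝ) (l : List V14) : ℝ :=
  ((l.zip l.tail).map (fun e => 1 / (1 - edgeFlow x e / 10))).sum

/-- A feasible path flow on edge set `E'`: nonnegative, supported on directed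
`s`–`t` paths of `E'`, and routing a total demand of `5` from `s` to `t`. -/
def FeasibleFlow (E' : Finset (V14 × V14)) (x : List V14 →₀ ℝ) : Prop :=
  (∀ l, 0 ≤ x l) ∧ (∀ l ∈ x.support, IsSTPath E' l) ∧ (∑ l ∈ x.support, x l) = 5

/-- A Wardrop (user) equilibrium on edge set `E'`: a feasible path flow such
that every `s`–`t` path of `E'` carrying positive flow has cost at most the
cost of every other `s`–`t` path of `E'`. -/
def IsWardrop (E' : Finset (V14 × V14)) (x : List V14 →₀ ℝ) : Prop :=
  FeasibleFlow E' x ∧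
  ∀ p1 p2 : List V14, IsSTPath E' p1 → IsSTPath E' p2 → 0 < x p1 →
    pathCost x p1 ≤ pathCost x p2

/-- The total travel time of a path flow: `∑ e x_e·c(x_e)` with
`c(x) = 1/(1 − x/10)`. -/
noncomputable def totalTime (E' : Finset (V14 × V14)) (x : List V14 →₀ ℝ) : ℝ :=
  ∑ e ∈ E', edgeFlow x e * (1 / (1 - edgeFlow x e / 10))

/-- The flow sending all 5 units along the black path `(s,a,b,t)`. -/
noncomputable def blackFlow : List V14 →₀ ℝ := Finsupp.single [s, a, b, t] 5

/-- The flow sending `35/8` units along `(s,a,b,t)` and `5/8` units along the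
5-edge path `(s,b1,m1,m2,c5,t)`. -/
noncomputable def mixedFlow : List V14 →₀ ℝ :=
  Finsupp.single [s, a, b, t] (35 / 8) + Finsupp.single [s, b1, m1, m2, c5, t] (5 / 8)

theorem sub_le_pathCost {E' : Finset (V14 × V14)} {x : List V14 →₀ ℝ} (φ : V14 → ℝ)
    (hφ : ∀ e ∈ E', φ e.2 - φ e.1 ≤ 1 / (1 - edgeFlow x e / 10)) {l : List V14} {u v : V14}
    (hl : l.IsChain (fun x y => (x, y) ∈ E')) (hu : l.head? = some u)
    (hv : l.getLast? = some v) : φ v - φ u ≤ pathCost x l := by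
  induction l generalizing u with
  | nil => simp at hu
  | cons w l ih =>
    obtain rfl : w = u := by simpa using hu
    cases l with
    | nil =>
      obtain rfl : w = v := by simpa using hv
      simp [pathCost]
    | cons z l =>
      rw [List.isChain_cons_cons] at hl
      have hz := ih hl.2 rfl (by simpa [List.getLast?_cons_cons] using hv)
      have hwz := hφ _ hl.1
      simp only [pathCost, List.tail_cons, List.zip_cons_cons, List.map_cons, List.sum_cons]
        at hz hwz ⊢
      linarith

/-- A feasible flow is a Wardrop equilibrium as soon as some vertex potential certifies that
its used paths are shortest paths. -/
theorem FeasibleFlow.isWardrop {E' : Finset (V14 × V14)} {x : List V14 →₀ ℝ}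
    (hx : FeasibleFlow E' x) (φ : V14 → ℝ)
    (hφ : ∀ e ∈ E', φ e.2 - φ e.1 ≤ 1 / (1 - edgeFlow x e / 10))
    (hcost : ∀ p, 0 < x p → pathCost x p ≤ φ t - φ s) : IsWardrop E' x :=
  ⟨hx, fun p₁ _ _ h₂ hp => (hcost p₁ hp).trans (sub_le_pathCost φ hφ h₂.1 h₂.2.2.1 h₂.2.2.2)⟩

theorem IsSTPath.mono {E' E'' : Finset (V14 × V14)} (h : E' ⊆ E'') {l : List V14}
    (hl : IsSTPath E' l) : IsSTPath E'' l :=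
  ⟨hl.1.imp fun _ _ he => h he, hl.2⟩

theorem edgeFlow_single (p : List V14) (r : ℝ) (e : V14 × V14) :
    edgeFlow (Finsupp.single p r) e = if e ∈ p.zip p.tail then r else 0 :=
  Finsupp.sum_single_index (h := fun (l : List V14) (r : ℝ) => if e ∈ l.zip l.tail then r else 0) (by simp)

theorem edgeFlow_add (x y : List V14 →₀ ℝ) (e : V14 × V14) :
    edgeFlow (x + y) e = edgeFlow x e + edgeFlow y e :=
  Finsupp.sum_add_index' (h := fun (l : List V14) (r : ℝ) => if e ∈ l.zip l.tail then r else 0) (by simp)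
    (by intros; split_ifs <;> simp)

theorem edgeFlow_blackFlow (e : V14 × V14) :
    edgeFlow blackFlow e = if e ∈ blackEdges then 5 else 0 := by
  simp [blackFlow, edgeFlow_single, blackEdges]

theorem edgeFlow_mixedFlow (e : V14 × V14) :
    edgeFlow mixedFlow e = (if e ∈ blackEdges then 35 / 8 else 0) +
      if e ∈ [(s, b1), (b1, m1), (m1, m2), (m2, c5), (c5, t)] then 5 / 8 else 0 := by
  simp [mixedFlow, edgeFlow_add, edgeFlow_single, blackEdges]

theorem isSTPath_black : IsSTPath blackEdges [s, a, b, t] :=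
  ⟨(by simp [blackEdges] : List.IsChain _ _), by simp, rfl, rfl⟩

theorem feasibleFlow_blackFlow {E' : Finset (V14 × V14)} (h : blackEdges ⊆ E') :
    FeasibleFlow E' blackFlow := by
  refine ⟨fun l => ?_, fun l hl => ?_, ?_⟩
  · exact Finsupp.single_nonneg.2 (by norm_num : (0 : ℝ) ≤ 5) l
  · obtain rfl := Finset.mem_singleton.1 (Finsupp.support_single_subset hl)
    exact isSTPath_black.mono h
  · exact Finsupp.sum_single_index (h := fun _ r => r) rfl

theorem feasibleFlow_mixedFlow :
    FeasibleFlow (blackEdges ∪ orangeEdges ∪ blueEdges) mixedFlow := by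
  refine ⟨fun l => ?_, fun l hl => ?_, ?_⟩
  · exact add_nonneg (Finsupp.single_nonneg.2 (by norm_num : (0 : ℝ) ≤ 35 / 8) l)
      (Finsupp.single_nonneg.2 (by norm_num : (0 : ℝ) ≤ 5 / 8) l)
  · rcases Finset.mem_union.1 (Finsupp.support_add hl) with hl | hl
    · obtain rfl := Finset.mem_singleton.1 (Finsupp.support_single_subset hl)
      exact isSTPath_black.mono (by decide)
    · obtain rfl := Finset.mem_singleton.1 (Finsupp.support_single_subset hl)
      exact ⟨(by simp [blackEdges, orangeEdges, blueEdges] : List.IsChain _ _), by simp, rfl, rfl⟩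
  · refine (Finsupp.sum_add_index' (h := fun _ r => r) (by simp) (by simp)).trans ?_
    rw [Finsupp.sum_single_index rfl, Finsupp.sum_single_index rfl]
    norm_num

/-- Shortest-path potential for the black and orange edges when all flow is on the black path. -/
def orangePotential : V14 → ℝ
  | s => 0 | t => 6 | a => 2 | b => 4 | c1 => 1 | c2 => 2 | c3 => 4 | c4 => 5 | c5 => 7
  | m1 => 3 | m2 => 6 | _ => 0

/-- Shortest-path potential for the black and blue edges when all flow is on the black path. -/
def bluePotential : V14 → ℝ
  | s => 0 | t => 6 | a => 2 | b => 4 | b1 => 1 | b2 => 5 | b3 => 6 | m1 => 2 | m2 => 3 | _ => 0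

/-- Distances from `s` in the full network under the mixed flow. -/
noncomputable def mixedPotential : V14 → ℝ
  | s => 0 | t => 16 / 3 | a => 16 / 9 | b => 32 / 9 | c1 => 1 | c2 => 2 | c3 => 47 / 15
  | c4 => 62 / 15 | c5 => 64 / 15 | b1 => 16 / 15 | b2 => 41 / 9 | b3 => 50 / 9
  | m1 => 32 / 15 | m2 => 48 / 15

theorem isWardrop_blackFlow {E' : Finset (V14 × V14)} (h : blackEdges ⊆ E') (φ : V14 → ℝ)
    (hφ : ∀ e ∈ E', φ e.2 - φ e.1 ≤ if e ∈ blackEdges then 2 else 1)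
    (hst : φ t - φ s = 6) : IsWardrop E' blackFlow := by
  refine (feasibleFlow_blackFlow h).isWardrop φ (fun e he => (hφ e he).trans_eq ?_)
    fun p hp => ?_
  · rw [edgeFlow_blackFlow]
    split_ifs <;> norm_num
  · obtain rfl : p = [s, a, b, t] := by
      by_contra hne
      simp [blackFlow, Ne.symm hne] at hp
    rw [hst]
    simp [pathCost, edgeFlow_blackFlow, blackEdges]
    norm_num

theorem totalTime_blackFlow {E' : Finset (V14 × V14)} (h : blackEdges ⊆ E') :
    totalTime E' blackFlow = 30 := by
  rw [totalTime, ← Finset.sum_subset h fun e _ he => by simp [edgeFlow_blackFlow, he]]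
  simp [edgeFlow_blackFlow, blackEdges]
  norm_num

theorem isWardrop_mixedFlow :
    IsWardrop (blackEdges ∪ orangeEdges ∪ blueEdges) mixedFlow := by
  refine feasibleFlow_mixedFlow.isWardrop mixedPotential ?_ fun p hp => ?_
  · simp only [edgeFlow_mixedFlow]
    simp [blackEdges, orangeEdges, blueEdges, mixedPotential]
    norm_num
  · have : p = [s, a, b, t] ∨ p = [s, b1, m1, m2, c5, t] := by
      by_contra! hne
      simp [mixedFlow, hne.1.symm, hne.2.symm] at hp
    rcases this with rfl | rfl <;>
      simp [pathCost, edgeFlow_mixedFlow, blackEdges, mixedPotential] <;>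
      norm_num

theorem totalTime_mixedFlow :
    totalTime (blackEdges ∪ orangeEdges ∪ blueEdges) mixedFlow = 80 / 3 := by
  rw [totalTime, Finset.sum_union (by decide), Finset.sum_union (by decide)]
  simp [edgeFlow_mixedFlow, blackEdges, orangeEdges, blueEdges]
  norm_num

/-- (i) On each of the edge sets `I`, `I ∪ X`, `I ∪ Y`, the flow sending all
5 units along the black path is a Wardrop equilibrium with total travel time
30; (ii) on `I ∪ X ∪ Y`, the flow sending `35/8` units along `(s,a,b,t)` and
`5/8` units along `(s,b1,m1,m2,c5,t)` is a Wardrop equilibrium with total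
travel time `80/3`; consequently `30 − 30 < 30 − 80/3`, so the total travel
time at user equilibrium is NOT supermodular with respect to path
additions. -/
theorem ue_not_supermodular :
    IsWardrop blackEdges blackFlow ∧
    totalTime blackEdges blackFlow = 30 ∧
    IsWardrop (blackEdges ∪ orangeEdges) blackFlow ∧
    totalTime (blackEdges ∪ orangeEdges) blackFlow = 30 ∧
    IsWardrop (blackEdges ∪ blueEdges) blackFlow ∧
    totalTime (blackEdges ∪ blueEdges) blackFlow = 30 ∧
    IsWardrop (blackEdges ∪ orangeEdges ∪ blueEdges) mixedFlow ∧
    totalTime (blackEdges ∪ orangeEdges ∪ blueEdges) mixedFlow = 80 / 3 ∧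
    (30 : ℝ) - 30 < 30 - 80 / 3 := by
  refine ⟨isWardrop_blackFlow subset_rfl orangePotential ?_ ?_, totalTime_blackFlow subset_rfl,
    isWardrop_blackFlow Finset.subset_union_left orangePotential ?_ ?_,
    totalTime_blackFlow Finset.subset_union_left,
    isWardrop_blackFlow Finset.subset_union_left bluePotential ?_ ?_,
    totalTime_blackFlow Finset.subset_union_left,
    isWardrop_mixedFlow, totalTime_mixedFlow, by norm_num⟩ <;>
  simp [blackEdges, orangeEdges, blueEdges, orangePotential, bluePotential] <;> norm_num
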